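/- Let p be a prime number, N ≥ 1 an integer, G a subgroup of (ℤ/p^Nℤ)ˣ acting on M = ℤ/p^Nℤ by multiplication, and G′ a proper subgroup of G. Then the restriction map H¹(G, M) → H¹(G′, M) is the zero map; equivalently, for every 1-cocycle f : G → M (satisfying f(gh) = f(g) + g·f(h)) there exists m ∈ M such that f(g) = g·m − m for all g ∈ G′. -/

import Mathlib

/-- `f : G → ℤ/nℤ` is a 1-cocycle for the subgroup `G ≤ (ℤ/nℤ)ˣ` acting on `M = ℤ/nℤ`
by multiplication: `f(gh) = f(g) + g·f(h)` for all `g, h ∈ G`. -/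
def IsCocycle {n : ℕ} (G : Subgroup (ZMod n)ˣ) (f : G → ZMod n) : Prop :=
  ∀ g h : G, f (g * h) = f g + ((g : (ZMod n)ˣ) : ZMod n) * f h

namespace IsCocycle

variable {n : ℕ} {G : Subgroup (ZMod n)ˣ} {f : G → ZMod n}

theorem map_one (hf : IsCocycle G f) : f 1 = 0 := by
  simpa using hf 1 1

/-- The subgroup of those `g` at which `f` agrees with the coboundary `g ↦ g • m - m`. -/
def coboundaryLocus (hf : IsCocycle G f) (m : ZMod n) : Subgroup G where
  carrier := {g | f g = ((g : (ZMod n)ˣ) : ZMod n) * m - m}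
  one_mem' := by simp [hf.map_one]
  mul_mem' := by
    intro a b ha hb
    simp only [Set.mem_ofPred_eq] at ha hb ⊢
    rw [hf, ha, hb]
    push_cast
    ring
  inv_mem' := by
    intro a ha
    simp only [Set.mem_ofPred_eq] at ha ⊢
    have h := hf a a⁻¹
    rw [mul_inv_cancel, hf.map_one, ha] at h
    have h1 : ((a : (ZMod n)ˣ) : ZMod n) * (((a : (ZMod n)ˣ)⁻¹ : (ZMod n)ˣ) : ZMod n) = 1 :=
      Units.mul_inv _
    rw [← (a : (ZMod n)ˣ).isUnit.mul_right_inj, InvMemClass.coe_inv]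
    linear_combination -h - m * h1

theorem mem_coboundaryLocus (hf : IsCocycle G f) {m : ZMod n} {g : G} :
    g ∈ hf.coboundaryLocus m ↔ f g = ((g : (ZMod n)ˣ) : ZMod n) * m - m :=
  Iff.rfl

theorem sub_coboundary (hf : IsCocycle G f) (m : ZMod n) :
    IsCocycle G fun g => f g - (((g : (ZMod n)ˣ) : ZMod n) * m - m) := by
  intro g h
  dsimp only
  rw [hf]
  push_cast
  ring

theorem map_pow (hf : IsCocycle G f) (g : G) (k : ℕ) :
    f (g ^ k) = (∑ i ∈ Finset.range k, ((g : (ZMod n)ˣ) : ZMod n) ^ i) * f g := by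
  induction k with
  | zero => simp [hf.map_one]
  | succ k ih =>
    rw [pow_succ, hf, ih, Finset.sum_range_succ]
    push_cast
    ring

end IsCocycle

namespace ZMod

theorem isUnit_intCast_of_not_dvd {p : ℕ} (hp : p.Prime) (N : ℕ) {x : ℤ} (hx : ¬ (p : ℤ) ∣ x) :
    IsUnit (x : ZMod (p ^ N)) := by
  rw [ZMod.coe_int_isUnit_iff_isCoprime]
  push_cast
  exact ((Nat.prime_iff_prime_int.mp hp).coprime_iff_not_dvd.mpr hx).pow_left

theorem isUnit_or_natCast_dvd {p : ℕ} (hp : p.Prime) (N : ℕ) (x : ZMod (p ^ N)) :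
    IsUnit x ∨ (p : ZMod (p ^ N)) ∣ x := by
  obtain ⟨x, rfl⟩ := ZMod.intCast_surjective x
  by_cases hx : (p : ℤ) ∣ x
  · right
    simpa using (Int.castRingHom (ZMod (p ^ N))).map_dvd hx
  · exact Or.inl (isUnit_intCast_of_not_dvd hp N hx)

/-- For `x = 1 + p ^ a * w` with `w` prime to `p` and `a` large enough, the norm element of the
group generated by `x` modulo `p ^ N` kills only multiples of `x - 1`. -/
theorem dvd_of_geom_sum_mul_eq_zero {p : ℕ} (hp : p.Prime) {N a : ℕ} (ha : a ≠ 0)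
    (hpa : a + 2 ≤ p * a) (haN : a ≤ N) {w : ℤ} (hw : ¬ (p : ℤ) ∣ w) {y : ZMod (p ^ N)}
    (hy : (∑ i ∈ Finset.range (p ^ (N - a)), (1 + p ^ a * w : ZMod (p ^ N)) ^ i) * y = 0) :
    (p ^ a * w : ZMod (p ^ N)) ∣ y := by
  have hp0 : (p : ℤ) ≠ 0 := by exact_mod_cast hp.ne_zero
  obtain ⟨z, hz⟩ := exists_one_add_mul_pow_prime_pow_eq (R := ℤ) (u := p ^ a) (v := p) hp
    (dvd_pow_self _ ha)
    (by
      rw [← pow_succ', ← pow_succ, ← pow_mul, mul_comm a]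
      exact pow_dvd_pow _ hpa) w (N - a)
  have hS : (∑ i ∈ Finset.range (p ^ (N - a)), (1 + p ^ a * w : ℤ) ^ i) * w
      = p ^ (N - a) * (w + p * z) := by
    have h := geom_sum_mul (1 + (p : ℤ) ^ a * w) (p ^ (N - a))
    rw [hz] at h
    refine mul_left_cancel₀ (pow_ne_zero a hp0) ?_
    linear_combination h
  have hS' := congrArg (Int.cast : ℤ → ZMod (p ^ N)) hS
  push_cast at hS'
  have hwz : IsUnit ((w + p * z : ℤ) : ZMod (p ^ N)) :=
    isUnit_intCast_of_not_dvd hp N fun h => hw ((dvd_add_left (dvd_mul_right _ _)).mp h)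
  push_cast at hwz
  have hy' : (p : ZMod (p ^ N)) ^ (N - a) * y = 0 := by
    rw [← hwz.mul_right_eq_zero]
    linear_combination w * hy - y * hS'
  obtain ⟨y, rfl⟩ := ZMod.intCast_surjective y
  have hdvd : (p : ℤ) ^ a ∣ y := by
    have h : ((p ^ (N - a) * y : ℤ) : ZMod (p ^ N)) = 0 := by exact_mod_cast hy'
    rw [ZMod.intCast_zmod_eq_zero_iff_dvd] at h
    push_cast at h
    nth_rewrite 1 [← Nat.sub_add_cancel haN] at h
    rw [pow_add] at h
    exact Int.dvd_of_mul_dvd_mul_left (pow_ne_zero _ hp0) h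
  rw [(isUnit_intCast_of_not_dvd hp N hw).mul_right_dvd]
  simpa using (Int.castRingHom (ZMod (p ^ N))).map_dvd hdvd

/-- The kernel of reduction modulo `4` on `(ℤ/2ⁿℤ)ˣ` is cyclic, generated by `5`. -/
theorem isCyclic_ker_unitsMap_four (n : ℕ) (h : 4 ∣ 2 ^ (n + 2)) :
    IsCyclic (ZMod.unitsMap h).ker := by
  have h5 : IsUnit (5 : ZMod (2 ^ (n + 2))) := by
    exact_mod_cast isUnit_intCast_of_not_dvd Nat.prime_two (n + 2) (x := 5) (by norm_num)
  have hmem : h5.unit ∈ (ZMod.unitsMap h).ker := by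
    rw [MonoidHom.mem_ker, Units.ext_iff, ZMod.unitsMap_val, IsUnit.unit_spec]
    have : ((5 : ZMod (2 ^ (n + 2))).cast : ZMod 4) = ZMod.castHom h (ZMod 4) 5 := rfl
    rw [this, map_ofNat]
    rfl
  have hcard : Nat.card (ZMod.unitsMap h).ker = 2 ^ n := by
    have h1 := (ZMod.unitsMap h).ker.card_mul_index
    rw [Subgroup.index_ker, MonoidHom.range_eq_top.mpr (ZMod.unitsMap_surjective h),
      Subgroup.card_top, Nat.card_eq_fintype_card (α := (ZMod 4)ˣ),
      Nat.card_eq_fintype_card (α := (ZMod (2 ^ (n + 2)))ˣ), ZMod.card_units_eq_totient,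
      ZMod.card_units_eq_totient, Nat.totient_prime_pow_succ Nat.prime_two,
      show Nat.totient 4 = 2 by decide] at h1
    have h2 : 2 ^ (n + 1) = 2 ^ n * 2 := pow_succ 2 n
    omega
  refine isCyclic_of_orderOf_eq_card ⟨h5.unit, hmem⟩ ?_
  rw [hcard, ← orderOf_five n, Subgroup.orderOf_mk, ← orderOf_units, IsUnit.unit_spec]

end ZMod

namespace IsCocycle

theorem exists_eq_of_dvd_sub_one {p : ℕ} (hp : p.Prime) {N c : ℕ} (hc : c ≠ 0)
    (hpc : c + 2 ≤ p * c) {G : Subgroup (ZMod (p ^ N))ˣ} {f : G → ZMod (p ^ N)}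
    (hf : IsCocycle G f) {g : G}
    (hg : (p : ZMod (p ^ N)) ^ c ∣ ((g : (ZMod (p ^ N))ˣ) : ZMod (p ^ N)) - 1) :
    ∃ m, f g = ((g : (ZMod (p ^ N))ˣ) : ZMod (p ^ N)) * m - m := by
  rcases eq_or_ne g 1 with rfl | hg1
  · exact ⟨0, by simp [hf.map_one]⟩
  obtain ⟨k, hk⟩ := hg
  obtain ⟨k, rfl⟩ := ZMod.intCast_surjective k
  have hD : ¬ (p : ℤ) ^ N ∣ p ^ c * k := by
    intro h
    apply hg1
    have h0 : ((p ^ c * k : ℤ) : ZMod (p ^ N)) = 0 := by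
      rw [ZMod.intCast_zmod_eq_zero_iff_dvd]
      exact_mod_cast h
    push_cast at h0
    rw [h0, sub_eq_zero] at hk
    ext
    simpa using hk
  have hk0 : k ≠ 0 := by
    rintro rfl
    simp at hD
  obtain ⟨b, w, hw, rfl⟩ : ∃ b w, ¬ (p : ℤ) ∣ w ∧ k = p ^ b * w := by
    have hfin : FiniteMultiplicity (p : ℤ) k :=
      Int.finiteMultiplicity_iff.mpr ⟨by simpa using hp.ne_one, hk0⟩
    obtain ⟨w, h1, h2⟩ := hfin.exists_eq_pow_mul_and_not_dvd
    exact ⟨_, w, h2, h1⟩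
  have hle : c + b ≤ N := by
    by_contra! h
    apply hD
    rw [← mul_assoc, ← pow_add]
    exact (pow_dvd_pow _ h.le).mul_right _
  have hge : ((g : (ZMod (p ^ N))ˣ) : ZMod (p ^ N)) = 1 + p ^ (c + b) * w := by
    push_cast at hk
    linear_combination hk
  have hpcb : c + b + 2 ≤ p * (c + b) := by
    nlinarith [hp.two_le]
  have hpow : g ^ p ^ (N - (c + b)) = 1 := by
    obtain ⟨z, hz⟩ := ZMod.exists_one_add_mul_pow_prime_pow_eq (R := ZMod (p ^ N))
      (u := p ^ (c + b)) (v := p) hp (dvd_pow_self _ (by omega))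
      (by
        rw [← pow_succ', ← pow_succ, ← pow_mul, mul_comm (c + b)]
        exact pow_dvd_pow _ hpcb) (w : ZMod (p ^ N)) (N - (c + b))
    apply Subtype.ext
    apply Units.ext
    push_cast
    rw [hge, hz, ← pow_add, Nat.sub_add_cancel hle, ← Nat.cast_pow, ZMod.natCast_self]
    simp
  have hS := hf.map_pow g (p ^ (N - (c + b)))
  rw [hpow, hf.map_one, hge] at hS
  obtain ⟨m, hm⟩ := ZMod.dvd_of_geom_sum_mul_eq_zero hp (by omega) hpcb hle hw hS.symm
  refine ⟨m, ?_⟩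
  rw [hm, hge]
  ring

/-- For odd `p`, every cocycle is a coboundary. -/
theorem exists_coboundaryLocus_eq_top {p : ℕ} (hp : p.Prime) (hp2 : p ≠ 2) {N : ℕ}
    {G : Subgroup (ZMod (p ^ N))ˣ} {f : G → ZMod (p ^ N)} (hf : IsCocycle G f) :
    ∃ m, hf.coboundaryLocus m = ⊤ := by
  have := ZMod.isCyclic_units_of_prime_pow p hp hp2 N
  obtain ⟨s, hs⟩ := IsCyclic.exists_generator (α := G)
  suffices h : ∃ m, f s = ((s : (ZMod (p ^ N))ˣ) : ZMod (p ^ N)) * m - m by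
    obtain ⟨m, hm⟩ := h
    refine ⟨m, top_unique fun g _ => ?_⟩
    exact Subgroup.zpowers_le.mpr (hf.mem_coboundaryLocus.mpr hm) (hs g)
  rcases ZMod.isUnit_or_natCast_dvd hp N (((s : (ZMod (p ^ N))ˣ) : ZMod (p ^ N)) - 1) with h | h
  · obtain ⟨m, hm⟩ := h.dvd (a := f s)
    exact ⟨m, by rw [hm]; ring⟩
  · refine hf.exists_eq_of_dvd_sub_one hp one_ne_zero ?_ (by rwa [pow_one])
    have := hp.two_le
    omega

/-- A cocycle over `ℤ/2ᴺℤ` vanishing on the elements `≡ 1` modulo `4` of `G` is a coboundary on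
every proper subgroup. -/
theorem exists_le_coboundaryLocus_of_eq_zero {n : ℕ} {G : Subgroup (ZMod (2 ^ (n + 2)))ˣ}
    {f : G → ZMod (2 ^ (n + 2))} (hf : IsCocycle G f) {H G' : Subgroup G} [IsCyclic H]
    (hH : ∀ g : G, g ∈ H ↔ (4 : ZMod (2 ^ (n + 2))) ∣ ((g : (ZMod (2 ^ (n + 2)))ˣ) : ZMod _) - 1)
    (hH' : ∀ g : G, g ∉ H → (4 : ZMod (2 ^ (n + 2))) ∣ ((g : (ZMod (2 ^ (n + 2)))ˣ) : ZMod _) + 1)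
    (hH2 : ∀ g h : G, g ∉ H → h ∉ H → g * h ∈ H)
    (hG' : G' ≠ ⊤) (hf0 : ∀ g ∈ H, f g = 0) :
    ∃ m, G' ≤ hf.coboundaryLocus m := by
  by_cases hle : G' ≤ H
  · exact ⟨0, fun g hg => by simp [hf.mem_coboundaryLocus, hf0 g (hle hg)]⟩
  obtain ⟨t, ht', htH⟩ := SetLike.not_le_iff_exists.mp hle
  obtain ⟨⟨s, hsH⟩, hs⟩ := IsCyclic.exists_generator (α := H)
  replace hs : ∀ g ∈ H, ∃ k : ℕ, s ^ k = g := by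
    intro g hg
    obtain ⟨k, hk⟩ := mem_powers_iff_mem_zpowers.mpr (hs ⟨g, hg⟩)
    exact ⟨k, congrArg Subtype.val hk⟩
  have hsG' : s ∉ G' := by
    intro hsG'
    have hHG' : H ≤ G' := by
      intro g hg
      obtain ⟨k, rfl⟩ := hs g hg
      exact pow_mem hsG' k
    refine hG' (top_unique fun g _ => ?_)
    by_cases hg : g ∈ H
    · exact hHG' hg
    · exact (Subgroup.mul_mem_cancel_right G' ht').mp (hHG' (hH2 g t hg htH))
  have heven : ∀ g ∈ H, g ∈ G' → ∃ k : ℕ, (s ^ 2) ^ k = g := by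
    intro g hg hg'
    obtain ⟨k, rfl⟩ := hs g hg
    rcases Nat.even_or_odd' k with ⟨j, rfl | rfl⟩
    · exact ⟨j, (pow_mul s 2 j).symm⟩
    · refine absurd (Subgroup.zpowers_le.mpr hg' ?_) hsG'
      have hdvd : orderOf s ∣ 2 ^ (n + 1) := by
        rw [← Subgroup.orderOf_coe]
        have h := orderOf_dvd_natCard (s : (ZMod (2 ^ (n + 2)))ˣ)
        rw [Nat.card_eq_fintype_card, ZMod.card_units_eq_totient,
          Nat.totient_prime_pow_succ Nat.prime_two] at h
        simpa using h
      rw [mem_zpowers_pow_iff]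
      exact Nat.Coprime.coprime_dvd_right hdvd (Nat.Coprime.pow_right _ (by simp))
  obtain ⟨a, ha⟩ := (hH s).mp hsH
  obtain ⟨b, hb⟩ := hH' t htH
  have hcomm : (((s : (ZMod (2 ^ (n + 2)))ˣ) : ZMod (2 ^ (n + 2))) - 1) * f t = 0 := by
    have h1 := hf s t
    have h2 := hf t s
    rw [mul_comm t s, h1, hf0 s hsH] at h2
    linear_combination h2
  have hu : IsUnit (2 * b - 1) := by
    obtain ⟨b, rfl⟩ := ZMod.intCast_surjective b
    have h := ZMod.isUnit_intCast_of_not_dvd Nat.prime_two (n + 2) (x := 2 * b - 1) (by omega)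
    push_cast at h
    exact h
  obtain ⟨z, hz⟩ : (2 : ZMod (2 ^ (n + 2))) ∣ f t := by
    rcases ZMod.isUnit_or_natCast_dvd Nat.prime_two (n + 2) (f t) with h | h
    · rw [h.mul_left_eq_zero, sub_eq_zero] at hcomm
      refine absurd ?_ hsG'
      have : s = 1 := Subtype.ext (Units.ext hcomm)
      exact this ▸ one_mem G'
    · exact_mod_cast h
  obtain ⟨m, rfl⟩ := hu.dvd (a := z)
  have htm : t ∈ hf.coboundaryLocus m := by
    rw [hf.mem_coboundaryLocus]
    linear_combination hz - m * hb
  have hsm : s ^ 2 ∈ hf.coboundaryLocus m := by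
    rw [hf.mem_coboundaryLocus, hf0 _ (pow_mem hsH 2)]
    push_cast
    refine (hu.mul_right_eq_zero.mp ?_).symm
    linear_combination (1 + 2 * a) * hcomm -
      (((s : (ZMod (2 ^ (n + 2)))ˣ) : ZMod (2 ^ (n + 2))) - 1) * (1 + 2 * a) * hz +
      (((s : (ZMod (2 ^ (n + 2)))ˣ) : ZMod (2 ^ (n + 2))) - 1) * (2 * b - 1) * m * ha
  have hHm : ∀ g ∈ H, g ∈ G' → g ∈ hf.coboundaryLocus m := by
    intro g hg hg'
    obtain ⟨k, rfl⟩ := heven g hg hg'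
    exact pow_mem hsm k
  refine ⟨m, fun g hg' => ?_⟩
  by_cases hg : g ∈ H
  · exact hHm g hg hg'
  · exact (Subgroup.mul_mem_cancel_right _ htm).mp
      (hHm _ (hH2 g t hg htH) (mul_mem hg' ht'))

theorem exists_le_coboundaryLocus_of_two_pow {n : ℕ} {G : Subgroup (ZMod (2 ^ (n + 2)))ˣ}
    {f : G → ZMod (2 ^ (n + 2))} (hf : IsCocycle G f) {G' : Subgroup G} (hG' : G' ≠ ⊤) :
    ∃ m, G' ≤ hf.coboundaryLocus m := by
  have h4 : 4 ∣ 2 ^ (n + 2) := ⟨2 ^ n, by ring⟩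
  let φ := (ZMod.unitsMap h4).comp G.subtype
  let H : Subgroup G := φ.ker
  have hval (g : G) (k : ℤ) : ((φ g : ZMod 4) = k) ↔
      (4 : ZMod (2 ^ (n + 2))) ∣ ((g : (ZMod (2 ^ (n + 2)))ˣ) : ZMod (2 ^ (n + 2))) - k := by
    have : (φ g : ZMod 4) = ZMod.castHom h4 (ZMod 4) ((g : (ZMod (2 ^ (n + 2)))ˣ) : ZMod _) := rfl
    rw [this]
    obtain ⟨x, hx⟩ := ZMod.intCast_surjective ((g : (ZMod (2 ^ (n + 2)))ˣ) : ZMod (2 ^ (n + 2)))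
    rw [← hx, map_intCast, ← sub_eq_zero, ← Int.cast_sub, ZMod.intCast_zmod_eq_zero_iff_dvd,
      ← Int.cast_sub]
    constructor
    · intro h
      simpa using (Int.castRingHom (ZMod (2 ^ (n + 2)))).map_dvd h
    · intro h
      have h' := map_dvd (ZMod.castHom h4 (ZMod 4)) h
      rw [map_intCast, map_ofNat, show (OfNat.ofNat 4 : ZMod 4) = 0 from rfl, zero_dvd_iff,
        ZMod.intCast_zmod_eq_zero_iff_dvd] at h'
      exact h'
  have hcases : ∀ u : (ZMod 4)ˣ, u ≠ 1 → (u : ZMod 4) = -1 := by decide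
  have hmul : ∀ u v : (ZMod 4)ˣ, u ≠ 1 → v ≠ 1 → u * v = 1 := by decide
  have hH (g : G) : g ∈ H ↔
      (4 : ZMod (2 ^ (n + 2))) ∣ ((g : (ZMod (2 ^ (n + 2)))ˣ) : ZMod (2 ^ (n + 2))) - 1 := by
    have h := hval g 1
    rw [Int.cast_one, Int.cast_one, Units.val_eq_one] at h
    exact h
  have hcyc : IsCyclic H := by
    have := ZMod.isCyclic_ker_unitsMap_four n h4
    exact isCyclic_of_injective
      ((G.subtype.comp H.subtype).codRestrict (ZMod.unitsMap h4).ker fun g => g.2)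
      ((MonoidHom.injective_codRestrict _ _ _).mpr
        (G.subtype_injective.comp H.subtype_injective))
  obtain ⟨⟨s, hsH⟩, hs⟩ := IsCyclic.exists_generator (α := H)
  obtain ⟨m₀, hm₀⟩ := hf.exists_eq_of_dvd_sub_one Nat.prime_two two_ne_zero (by norm_num)
    (g := s) (by convert (hH s).mp hsH using 1; norm_num)
  have hHm₀ : H ≤ hf.coboundaryLocus m₀ := by
    intro g hg
    obtain ⟨k, hk⟩ := hs ⟨g, hg⟩
    rw [← show s ^ k = g from congrArg Subtype.val hk]
    exact zpow_mem (hf.mem_coboundaryLocus.mpr hm₀) k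
  obtain ⟨m, hm⟩ := (hf.sub_coboundary m₀).exists_le_coboundaryLocus_of_eq_zero hH
    (fun g hg => by simpa using (hval g (-1)).mp (by simpa using hcases (φ g) hg))
    (fun g h hg hh => by
      rw [MonoidHom.mem_ker, map_mul]
      exact hmul _ _ hg hh)
    hG' (fun g hg => sub_eq_zero.mpr (hHm₀ hg))
  refine ⟨m₀ + m, fun g hg => ?_⟩
  have h := (mem_coboundaryLocus _).mp (hm hg)
  rw [mem_coboundaryLocus]
  linear_combination h

end IsCocycle

/-- Let `p` be a prime, `N ≥ 1`, `G ≤ (ℤ/p^Nℤ)ˣ` acting on `M = ℤ/p^Nℤ` by multiplication, and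
`G′` a proper subgroup of `G`. Then the restriction map `H¹(G, M) → H¹(G′, M)` is zero: for every
1-cocycle `f : G → M` there is `m ∈ M` with `f(g) = g·m − m` for all `g ∈ G′`. -/
theorem stmt_3 (p : ℕ) (hp : p.Prime) (N : ℕ) (hN : 1 ≤ N)
    (G G' : Subgroup (ZMod (p ^ N))ˣ) (hG' : G' < G)
    (f : G → ZMod (p ^ N)) (hf : IsCocycle G f) :
    ∃ m : ZMod (p ^ N), ∀ g : G, (g : (ZMod (p ^ N))ˣ) ∈ G' →
      f g = ((g : (ZMod (p ^ N))ˣ) : ZMod (p ^ N)) * m - m := by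
  have hne : G'.subgroupOf G ≠ ⊤ := by
    rw [Ne, Subgroup.subgroupOf_eq_top]
    exact hG'.not_ge
  suffices h : ∃ m, G'.subgroupOf G ≤ hf.coboundaryLocus m by
    obtain ⟨m, hm⟩ := h
    exact ⟨m, fun g hg => hm (Subgroup.mem_subgroupOf.mpr hg)⟩
  rcases eq_or_ne p 2 with rfl | hp2
  · obtain ⟨n, rfl⟩ | rfl : (∃ n, N = n + 2) ∨ N = 1 := by
      rcases Nat.lt_or_ge N 2 with h | h
      · exact Or.inr (by omega)
      · exact Or.inl ⟨N - 2, by omega⟩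
    · exact hf.exists_le_coboundaryLocus_of_two_pow hne
    · have : Subsingleton (ZMod (2 ^ 1))ˣ := inferInstanceAs (Subsingleton (ZMod 2)ˣ)
      exact absurd (Subsingleton.elim _ _) hne
  · obtain ⟨m, hm⟩ := hf.exists_coboundaryLocus_eq_top hp hp2
    exact ⟨m, hm ▸ le_top⟩
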